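/- Let p ≥ 5 be a prime, m a natural number, and M an m×5 matrix with integer entries each of whose rows belongs to S. Suppose M has rank 5 over ℚ and there exists a nonzero vector a ∈ (𝔽_p)⁵ with (M mod p)·a = 0. Then there exist five distinct row indices of M such that the 5×5 submatrix N formed by these rows has rank 5 over ℚ and rank exactly 4 over 𝔽_p. -/

import Mathlib

/-- The set of 45 integer row vectors whose coordinates are a permutation of `(1,1,0,0,0)`,
of `(2,1,1,0,0)`, or of `(1,1,1,1,0)` (the rows of the matrix `E`). -/
def Srows : Set (Fin 5 → ℤ) :=
  {v | ∃ σ : Equiv.Perm (Fin 5),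
    v = ![1, 1, 0, 0, 0] ∘ σ ∨ v = ![2, 1, 1, 0, 0] ∘ σ ∨ v = ![1, 1, 1, 1, 0] ∘ σ}

/-- **AM-GM** for the eigenvalues of a positive semidefinite matrix. -/
theorem Matrix.PosSemidef.det_le_trace_div_card_pow {n : Type*} [Fintype n] [DecidableEq n]
    [Nonempty n] {A : Matrix n n ℝ} (hA : A.PosSemidef) :
    A.det ≤ (A.trace / Fintype.card n) ^ Fintype.card n := by
  have hdet : A.det = ∏ i, hA.1.eigenvalues i := by
    simpa using hA.1.det_eq_prod_eigenvalues
  have htr : A.trace = ∑ i, hA.1.eigenvalues i := by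
    simpa using hA.1.trace_eq_sum_eigenvalues
  have hnn : 0 ≤ ∏ i, hA.1.eigenvalues i :=
    Finset.prod_nonneg fun i _ => hA.eigenvalues_nonneg i
  have h := Real.geom_mean_le_arith_mean Finset.univ (fun _ => 1) hA.1.eigenvalues
    (by simp) (by simp [Fintype.card_pos]) (fun i _ => hA.eigenvalues_nonneg i)
  simp only [Real.rpow_one, Finset.sum_const, Finset.card_univ, nsmul_eq_mul, mul_one,
    one_mul] at h
  rw [hdet, htr]
  calc ∏ i, hA.1.eigenvalues i
      = ((∏ i, hA.1.eigenvalues i) ^ ((Fintype.card n : ℝ)⁻¹)) ^ Fintype.card n := by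
        rw [Real.rpow_inv_natCast_pow hnn Fintype.card_ne_zero]
    _ ≤ _ := pow_le_pow_left₀ (Real.rpow_nonneg hnn _) h _

/-- A square matrix over a field whose determinant vanishes does not have full rank. -/
theorem Matrix.rank_lt_card_of_det_eq_zero {n K : Type*} [Fintype n] [DecidableEq n] [Field K]
    {A : Matrix n n K} (hA : A.det = 0) : A.rank < Fintype.card n := by
  obtain ⟨v, hv, hAv⟩ := Matrix.exists_mulVec_eq_zero_iff.mpr hA
  have hker : 0 < Module.finrank K (LinearMap.ker A.mulVecLin) := by
    have : Nontrivial (LinearMap.ker A.mulVecLin) :=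
      ⟨⟨v, by simpa using hAv⟩, 0, fun h => hv (congrArg Subtype.val h)⟩
    exact Module.finrank_pos
  have := LinearMap.finrank_range_add_finrank_ker A.mulVecLin
  rw [Module.finrank_fintype_fun_eq_card] at this
  rw [Matrix.rank]
  omega

/-- If the reduction of an integer matrix modulo a prime `p` has corank at least `2`, then `p ^ 2`
divides its determinant. -/
theorem Matrix.sq_dvd_det_of_rank_map_lt {p n : ℕ} [Fact p.Prime]
    (N : Matrix (Fin (n + 1)) (Fin (n + 1)) ℤ)
    (h : (N.map (Int.cast : ℤ → ZMod p)).rank < n) : (p : ℤ) ^ 2 ∣ N.det := by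
  have hp : Prime (p : ℤ) := Nat.prime_iff_prime_int.mp Fact.out
  have hadj : ∀ i j, (p : ℤ) ∣ N.adjugate i j := fun i j => by
    rw [Matrix.adjugate_fin_succ_eq_det_submatrix]
    refine Dvd.dvd.mul_left ?_ _
    rw [← ZMod.intCast_zmod_eq_zero_iff_dvd, Int.cast_det]
    by_contra hne
    have h1 := Matrix.rank_of_det_ne_zero hne
    have h2 := Matrix.rank_submatrix_le (N.map (Int.cast : ℤ → ZMod p)) j.succAbove i.succAbove
    rw [Matrix.submatrix_map] at h2
    exact (h1.symm.trans_le h2).not_gt (by simpa using h)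
  choose B hB using hadj
  have hdetadj : N.det ^ n = (p : ℤ) ^ (n + 1) * (Matrix.of B).det := by
    have : N.adjugate = (p : ℤ) • Matrix.of B := by
      ext i j
      simp [hB]
    have h := Matrix.det_adjugate N
    rw [this, Matrix.det_smul, Fintype.card_fin] at h
    exact h.symm
  have hdvd : (p : ℤ) ∣ N.det :=
    hp.dvd_of_dvd_pow (hdetadj ▸ (dvd_pow_self _ n.succ_ne_zero).mul_right _)
  obtain ⟨e, he⟩ := hdvd
  have he' : e ^ n = p * (Matrix.of B).det := by
    rw [he, mul_pow, pow_succ, mul_assoc] at hdetadj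
    exact mul_left_cancel₀ (pow_ne_zero _ hp.ne_zero) hdetadj
  rw [he, sq]
  exact mul_dvd_mul_left _ (hp.dvd_of_dvd_pow (he' ▸ dvd_mul_right _ _))

/-- The rows of a matrix of full column rank over a field contain a basis. -/
theorem Matrix.exists_submatrix_rank_eq {m K : Type*} {n : ℕ} [Fintype m] [Field K]
    (A : Matrix m (Fin n) K) (hA : A.rank = n) :
    ∃ f : Fin n → m, Function.Injective f ∧ (A.submatrix f id).rank = n := by
  obtain ⟨κ, g, hg, hspan, hli⟩ := exists_linearIndependent' K A.row
  have : Fintype κ := Fintype.ofInjective g hg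
  have hcard : Fintype.card κ = n := by
    rw [linearIndependent_iff_card_eq_finrank_span.mp hli, Set.finrank, hspan,
      ← Matrix.rank_eq_finrank_span_row, hA]
  let e := (Fintype.equivFinOfCardEq hcard).symm
  refine ⟨g ∘ e, hg.comp e.injective, ?_⟩
  have := (hli.comp e e.injective).rank_matrix (M := A.submatrix (g ∘ e) id)
  simpa using this

theorem Srows.even_sum {v : Fin 5 → ℤ} (hv : v ∈ Srows) : Even (∑ i, v i) := by
  obtain ⟨σ, rfl | rfl | rfl⟩ := hv <;>
  · simp only [Function.comp_apply]
    rw [Equiv.sum_comp σ]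
    decide

theorem Srows.weighted_norm_le {v : Fin 5 → ℤ} (hv : v ∈ Srows) :
    32 * ∑ i, v i ^ 2 - 5 * (∑ i, v i) ^ 2 ≤ 112 := by
  obtain ⟨σ, rfl | rfl | rfl⟩ := hv <;>
  · simp only [Function.comp_apply]
    rw [Equiv.sum_comp σ, Equiv.sum_comp σ fun i => (_ : Fin 5 → ℤ) i ^ 2]
    decide

/-- The Gram matrix of the quadratic form `32 ∑ xᵢ² - 5 (∑ xᵢ)²`. -/
noncomputable def weightMatrix : Matrix (Fin 5) (Fin 5) ℝ :=
  Matrix.of fun i j => (if i = j then 32 else 0) - 5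

theorem det_weightMatrix : weightMatrix.det = 7340032 := by
  have h : weightMatrix = (32 : ℝ) • (1 +
      Matrix.replicateCol Unit (fun _ : Fin 5 => (-5 / 32 : ℝ)) *
        Matrix.replicateRow Unit (fun _ : Fin 5 => (1 : ℝ))) := by
    ext i j
    simp only [weightMatrix, Matrix.of_apply, Matrix.smul_apply,
      Matrix.add_apply, Matrix.one_apply, Matrix.mul_apply, Matrix.replicateCol_apply,
      Matrix.replicateRow_apply, Finset.univ_unique, Finset.sum_singleton, smul_eq_mul]
    split_ifs <;> norm_num
  rw [h, Matrix.det_smul, Matrix.det_one_add_replicateCol_mul_replicateRow]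
  norm_num [dotProduct]

theorem dotProduct_weightMatrix_mulVec (x : Fin 5 → ℝ) :
    x ⬝ᵥ weightMatrix.mulVec x
      = 32 * ∑ i, x i ^ 2 - 5 * (∑ i, x i) ^ 2 := by
  simp [weightMatrix, dotProduct, Matrix.mulVec, Fin.sum_univ_five]
  ring

theorem posSemidef_weightMatrix : weightMatrix.PosSemidef := by
  refine .of_dotProduct_mulVec_nonneg ?_ fun x => ?_
  · ext i j
    simp [weightMatrix, eq_comm]
  · rw [star_trivial, dotProduct_weightMatrix_mulVec]
    have h1 := sq_sum_le_card_mul_sum_sq (s := Finset.univ) (f := x)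
    have h2 : 0 ≤ ∑ i, x i ^ 2 := Finset.sum_nonneg fun i _ => sq_nonneg _
    simp only [Finset.card_univ, Fintype.card_fin, Nat.cast_ofNat] at h1
    linarith

theorem det_sq_le_of_rows_mem_Srows (N : Matrix (Fin 5) (Fin 5) ℤ) (hN : ∀ i, N i ∈ Srows) :
    N.det ^ 2 ≤ 2401 := by
  set A := N.map (Int.cast : ℤ → ℝ) with hA
  set W := weightMatrix
  have hpsd : (A * W * A.conjTranspose).PosSemidef :=
    posSemidef_weightMatrix.mul_mul_conjTranspose_same A
  have hdiag : ∀ i, (A * W * A.conjTranspose) i i ≤ 112 := fun i => by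
    have h : (A * W * A.conjTranspose) i i = A i ⬝ᵥ W.mulVec (A i) := by
      rw [Matrix.dotProduct_mulVec]
      simp [Matrix.mul_apply, dotProduct, Matrix.vecMul]
    rw [h, dotProduct_weightMatrix_mulVec]
    have := Srows.weighted_norm_le (hN i)
    simp only [hA, Matrix.map_apply]
    exact_mod_cast this
  have htr : (A * W * A.conjTranspose).trace ≤ 560 := by
    have := Finset.sum_le_card_nsmul Finset.univ _ _ fun i _ => hdiag i
    simp only [Finset.card_univ, Fintype.card_fin] at this
    rw [Matrix.trace]
    simp only [Matrix.diag_apply]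
    norm_num at this ⊢
    exact this
  have hle := hpsd.det_le_trace_div_card_pow
  have hdetA : A.det = N.det := by rw [Int.cast_det]
  have hdetW : W.det = 7340032 := det_weightMatrix
  rw [Matrix.det_mul, Matrix.det_mul, Matrix.det_conjTranspose, star_trivial, hdetA, hdetW] at hle
  have htr' : 0 ≤ (A * W * A.conjTranspose).trace := hpsd.trace_nonneg
  have hpow : ((A * W * A.conjTranspose).trace / Fintype.card (Fin 5)) ^ Fintype.card (Fin 5)
      ≤ (112 : ℝ) ^ 5 := by
    rw [Fintype.card_fin]
    refine pow_le_pow_left₀ (by positivity) ?_ 5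
    push_cast
    linarith
  have : ((N.det : ℝ)) ^ 2 ≤ 2401 := by
    have := hle.trans hpow
    nlinarith
  exact_mod_cast this

theorem two_dvd_det_of_rows_mem_Srows (N : Matrix (Fin 5) (Fin 5) ℤ) (hN : ∀ i, N i ∈ Srows) :
    2 ∣ N.det := by
  have hfact : Fact (Nat.Prime 2) := ⟨Nat.prime_two⟩
  have : ((N.det : ℤ) : ZMod 2) = 0 := by
    rw [Int.cast_det]
    refine Matrix.exists_mulVec_eq_zero_iff.mp ⟨1, one_ne_zero, ?_⟩
    ext i
    have := (ZMod.intCast_zmod_eq_zero_iff_dvd _ 2).mpr (Srows.even_sum (hN i)).two_dvd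
    simpa [Matrix.mulVec, dotProduct] using this
  exact_mod_cast (ZMod.intCast_zmod_eq_zero_iff_dvd _ 2).mp this

theorem four_le_rank_map_of_rows_mem_Srows {p : ℕ} [Fact p.Prime] (hp5 : 5 ≤ p)
    (N : Matrix (Fin 5) (Fin 5) ℤ) (hN : ∀ i, N i ∈ Srows) (hdet : N.det ≠ 0) :
    4 ≤ (N.map (Int.cast : ℤ → ZMod p)).rank := by
  by_contra! hlt
  have hsq := Matrix.sq_dvd_det_of_rank_map_lt N hlt
  have hcop : IsCoprime (2 : ℤ) ((p : ℤ) ^ 2) := by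
    have : Nat.Coprime 2 p :=
      (Nat.coprime_primes Nat.prime_two Fact.out).mpr (by omega)
    exact (Nat.isCoprime_iff_coprime.mpr this).pow_right
  have hdvd := hcop.mul_dvd (two_dvd_det_of_rows_mem_Srows N hN) hsq
  have hle : 2 * (p : ℤ) ^ 2 ≤ |N.det| :=
    Int.le_of_dvd (abs_pos.mpr hdet) ((dvd_abs _ _).mpr hdvd)
  have hp5' : (5 : ℤ) ≤ p := by exact_mod_cast hp5
  have hbound := det_sq_le_of_rows_mem_Srows N hN
  rw [← sq_abs] at hbound
  have hfifty : 50 ≤ |N.det| := by nlinarith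
  nlinarith

/-- Let `p ≥ 5` be prime and `M` an `m×5` integer matrix with rows in `S`, of rank `5`
over `ℚ`, such that `(M mod p)·a = 0` for some nonzero vector `a` over `𝔽_p`.  Then some
`5×5` submatrix `N` of `M`, formed by five distinct rows, has rank `5` over `ℚ` and rank
exactly `4` over `𝔽_p`. -/
theorem exists_submatrix_rank_five_rank_four
    {p : ℕ} (hp : p.Prime) (hp5 : 5 ≤ p) {m : ℕ}
    (M : Matrix (Fin m) (Fin 5) ℤ) (hM : ∀ i, M i ∈ Srows)
    (hrk : (M.map (Int.cast : ℤ → ℚ)).rank = 5)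
    (a : Fin 5 → ZMod p) (ha : a ≠ 0)
    (haM : (M.map (Int.cast : ℤ → ZMod p)).mulVec a = 0) :
    ∃ f : Fin 5 → Fin m, Function.Injective f ∧
      ((M.submatrix f id).map (Int.cast : ℤ → ℚ)).rank = 5 ∧
      ((M.submatrix f id).map (Int.cast : ℤ → ZMod p)).rank = 4 := by
  have : Fact p.Prime := ⟨hp⟩
  obtain ⟨f, hf, hfrk⟩ := Matrix.exists_submatrix_rank_eq _ hrk
  refine ⟨f, hf, hfrk, ?_⟩
  have hdet : (M.submatrix f id).det ≠ 0 := fun h0 => by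
    have : ((M.submatrix f id).map (Int.cast : ℤ → ℚ)).det = 0 := by
      rw [← Int.cast_det, h0, Int.cast_zero]
    have := Matrix.rank_lt_card_of_det_eq_zero this
    rw [Fintype.card_fin] at this
    exact this.ne hfrk
  have hge := four_le_rank_map_of_rows_mem_Srows hp5 (M.submatrix f id) (fun i => hM (f i)) hdet
  have hdetp : ((M.submatrix f id).map (Int.cast : ℤ → ZMod p)).det = 0 :=
    Matrix.exists_mulVec_eq_zero_iff.mp ⟨a, ha, funext fun i => congrFun haM (f i)⟩
  have hlt := Matrix.rank_lt_card_of_det_eq_zero hdetp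
  rw [Fintype.card_fin] at hlt
  omega
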